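/- arXiv:math/0701543 — 5 statements merged into one kernel-verified Lean document; each statement's English description precedes it below -/
import Mathlib

section
/- Let G be a group, H a subset of G closed under the inversion map i : x ↦ x⁻¹, and k : H → H an involution (k ∘ k = id on H) such that for every H-composable pair (x,y) (i.e. x ∈ H, y ∈ H and xy ∈ H) the pairs (k(xy), ik(y)) and (k(x), iki(y)) are also H-composable and k(xy)·ik(y) = k(k(x)·iki(y)). Then for every y ∈ H for which there exists x ∈ H with (x,y) an H-composable pair, one has (k(y))⁻¹ = k((k(y⁻¹))⁻¹), equivalently ik(y) = kiki(y). -/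
/-- In a Δ-group `(G, H, k)` — a group `G` with a subset `H` closed under inversion
`i : x ↦ x⁻¹` and an involution `k : H → H` such that for every `H`-composable pair
`(x, y)` (i.e. `x, y, x*y ∈ H`) the pairs `(k(xy), ik(y))` and `(k(x), iki(y))` are
`H`-composable and `k(xy)·ik(y) = k(k(x)·iki(y))` — one has `i∘k∘i = k∘i∘k` on `H`:
for every `y ∈ H` for which there exists `x ∈ H` with `(x, y)` an `H`-composable pair,
`(k y)⁻¹ = k ((k y⁻¹)⁻¹)`, i.e. `ik(y) = kiki(y)`. -/
theorem delta_group_iki_eq_kik {G : Type*} [Group G] (H : Set G) (k : G → G)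
    (hinv : ∀ x ∈ H, x⁻¹ ∈ H)
    (hkH : ∀ x ∈ H, k x ∈ H)
    (hkk : ∀ x ∈ H, k (k x) = x)
    (hcomp1 : ∀ x ∈ H, ∀ y ∈ H, x * y ∈ H → k (x * y) * (k y)⁻¹ ∈ H)
    (hcomp2 : ∀ x ∈ H, ∀ y ∈ H, x * y ∈ H → k x * (k y⁻¹)⁻¹ ∈ H)
    (hid : ∀ x ∈ H, ∀ y ∈ H, x * y ∈ H →
      k (x * y) * (k y)⁻¹ = k (k x * (k y⁻¹)⁻¹)) :
    ∀ y ∈ H, (∃ x ∈ H, x * y ∈ H) → (k y)⁻¹ = k ((k y⁻¹)⁻¹) := by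
  rintro y hy ⟨x, hx, hxy⟩
  have hb : (k y)⁻¹ ∈ H := hinv _ (hkH y hy)
  have h := hid (k (x * y)) (hkH _ hxy) (k y)⁻¹ hb (hcomp1 x hx y hy hxy)
  rw [hid x hx y hy hxy, hkk _ (hcomp2 x hx y hy hxy), hkk _ hxy, inv_inv, hkk y hy,
    mul_inv_cancel_right, mul_assoc, mul_eq_left, mul_inv_eq_one] at h
  rw [h, hkk _ hb]
end

section
/- Let R be a (possibly noncommutative) ring with unit, and let x, y be units of R such that 1−x, 1−y and 1−xy are also units of R. Then (1−xy)(1−y)⁻¹ = 1 − (1−x)(1−y⁻¹)⁻¹. -/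
/-- The Δ-group identity in the group of units of a ring `R` with involution
`k(x) = 1 - x`: if `x`, `y`, `1 - x`, `1 - y` and `1 - x*y` are all units of `R`, then
`(1 - x*y)·(1 - y)⁻¹ = 1 - (1 - x)·(1 - y⁻¹)⁻¹`
(inverses written via `Ring.inverse`). -/
theorem units_delta_identity {R : Type*} [Ring R] (x y : R)
    (hx : IsUnit x) (hy : IsUnit y)
    (h1x : IsUnit (1 - x)) (h1y : IsUnit (1 - y)) (h1xy : IsUnit (1 - x * y)) :
    (1 - x * y) * Ring.inverse (1 - y) =
      1 - (1 - x) * Ring.inverse (1 - Ring.inverse y) := by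
  obtain ⟨u, rfl⟩ := hy
  obtain ⟨v, hv⟩ := h1y
  have hw : 1 - (↑u⁻¹ : R) = ↑(-(v * u⁻¹)) := by
    simp [hv, sub_mul]
  rw [Ring.inverse_unit, hw, ← hv, Ring.inverse_unit, Ring.inverse_unit]
  apply v.isUnit.mul_right_cancel
  simp only [inv_neg, mul_inv_rev, inv_inv, Units.val_neg, Units.val_mul, mul_neg,
    sub_neg_eq_add, add_mul, one_mul, mul_assoc, Units.inv_mul, mul_one]
  rw [hv]
  noncomm_ring
end

section
/- Let R be a ring and x, y units of R such that 1−x, 1−y and 1−xy are also units of R. Then: (a) (1−xy)(1−y)⁻¹ is a unit and 1−(1−xy)(1−y)⁻¹ is a unit; and (b) (1−x)(1−y⁻¹)⁻¹ is a unit and 1−(1−x)(1−y⁻¹)⁻¹ is a unit. In other words, with H = {z ∈ R* : 1−z ∈ R*} and k(z) = 1−z, for every H-composable pair (x,y) the pairs (k(xy), (k(y))⁻¹) and (k(x), (k(y⁻¹))⁻¹) are H-composable. -/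
theorem isUnit_mul_inverse_and_one_sub {R : Type*} [Ring R] {a b : R}
    (ha : IsUnit a) (hb : IsUnit b) (hba : IsUnit (b - a)) :
    IsUnit (a * Ring.inverse b) ∧ IsUnit (1 - a * Ring.inverse b) := by
  refine ⟨ha.mul hb.ringInverse, ?_⟩
  rw [← Ring.mul_inverse_cancel b hb, ← sub_mul]
  exact hba.mul hb.ringInverse

/-- Composability in the canonical Δ-group of a ring: if `x`, `y`, `1 - x`, `1 - y`
and `1 - x*y` are units of `R`, then with `k(z) = 1 - z`:
(a) `(1 - x*y)·(1 - y)⁻¹` and `1 - (1 - x*y)·(1 - y)⁻¹` are units, and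
(b) `(1 - x)·(1 - y⁻¹)⁻¹` and `1 - (1 - x)·(1 - y⁻¹)⁻¹` are units;
i.e. the pairs `(k(xy), (k y)⁻¹)` and `(k x, (k y⁻¹)⁻¹)` are `H`-composable for
`H = {z ∈ Rˣ : 1 - z ∈ Rˣ}`. -/
theorem units_delta_composable {R : Type*} [Ring R] (x y : R)
    (hx : IsUnit x) (hy : IsUnit y)
    (h1x : IsUnit (1 - x)) (h1y : IsUnit (1 - y)) (h1xy : IsUnit (1 - x * y)) :
    (IsUnit ((1 - x * y) * Ring.inverse (1 - y)) ∧
      IsUnit (1 - (1 - x * y) * Ring.inverse (1 - y))) ∧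
    (IsUnit ((1 - x) * Ring.inverse (1 - Ring.inverse y)) ∧
      IsUnit (1 - (1 - x) * Ring.inverse (1 - Ring.inverse y))) := by
  have h1y' : 1 - Ring.inverse y = -((1 - y) * Ring.inverse y) := by
    rw [sub_mul, one_mul, Ring.mul_inverse_cancel y hy, neg_sub]
  refine ⟨isUnit_mul_inverse_and_one_sub h1xy h1y ?_, isUnit_mul_inverse_and_one_sub h1x ?_ ?_⟩
  · have h : 1 - y - (1 - x * y) = -((1 - x) * y) := by noncomm_ring
    rw [h]
    exact (h1x.mul hy).neg
  · rw [h1y']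
    exact (h1y.mul hy.ringInverse).neg
  · have h : 1 - Ring.inverse y - (1 - x) = -((1 - x * y) * Ring.inverse y) := by
      rw [sub_mul, one_mul, mul_assoc, Ring.mul_inverse_cancel y hy, mul_one]
      abel
    rw [h]
    exact (h1xy.mul hy.ringInverse).neg
end

section
/- Let R be a ring. Equip the set R* × R (R* the group of units of R) with the group structure (x,y)(u,v) = (xu, xv+y), unit (1,0), and inversion (x,y)⁻¹ = (x⁻¹, −x⁻¹y), and define k(x,y) = (y,x) on the subset H = R* × R*. Then for all p = (x,y) and q = (u,v) with x, y, u, v ∈ R* and xv+y ∈ R* (i.e. (p,q) is an H-composable pair), the Δ-group identity holds: k(pq)·(k(q))⁻¹ = k(k(p)·(k(q⁻¹))⁻¹); explicitly, both sides are computed from the common element ((xv+y)v⁻¹, −yv⁻¹u) of R* × R*, namely k(pq)·(k(q))⁻¹ = ((xv+y)v⁻¹, −yv⁻¹u) and k(p)·(k(q⁻¹))⁻¹ = (−yv⁻¹u, yv⁻¹+x). -/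
attribute [local instance] Classical.propDecidable

/-- The multiplication `(x,y)(u,v) = (xu, xv+y)` of the group `Rˣ × R`. -/
def dmul {R : Type*} [Ring R] (p q : Rˣ × R) : Rˣ × R :=
  (p.1 * q.1, (p.1 : R) * q.2 + p.2)

/-- The inversion `(x,y)⁻¹ = (x⁻¹, -x⁻¹ y)` of the group `Rˣ × R`. -/
def dinv {R : Type*} [Ring R] (p : Rˣ × R) : Rˣ × R :=
  (p.1⁻¹, -((p.1⁻¹ : Rˣ) : R) * p.2)

/-- The involution `k(x,y) = (y,x)` on the subset `H = Rˣ × Rˣ` of `Rˣ × R`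
(extended by the identity off `H`). -/
noncomputable def dk {R : Type*} [Ring R] (p : Rˣ × R) : Rˣ × R :=
  if h : IsUnit p.2 then (h.unit, (p.1 : R)) else p

/-- On `Rˣ × Rˣ` the map `dk` swaps the two coordinates. -/
theorem dk_of_unit {R : Type*} [Ring R] (a b : Rˣ) :
    dk (a, (b : R)) = (b, (a : R)) := by
  simp only [dk, dif_pos b.isUnit]
  exact Prod.ext (Units.ext rfl) rfl

theorem dmul_dk_dmul_dinv_dk {R : Type*} [Ring R] (x y u v w : Rˣ)
    (hw : (w : R) = x * v + y) :
    dmul (dk (dmul (x, (y : R)) (u, (v : R)))) (dinv (dk (u, (v : R)))) =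
      (w * v⁻¹, ((-(y * v⁻¹ * u) : Rˣ) : R)) := by
  have h : dmul (x, (y : R)) (u, (v : R)) = (x * u, (w : R)) := by rw [hw]; rfl
  rw [h, dk_of_unit, dk_of_unit]
  refine Prod.ext rfl ?_
  simp only [dmul, dinv, hw]
  push_cast
  simp [add_mul, mul_assoc]

theorem dmul_dk_dinv_dk_dinv {R : Type*} [Ring R] (x y u v : Rˣ) :
    dmul (dk (x, (y : R))) (dinv (dk (dinv (u, (v : R))))) =
      (-(y * v⁻¹ * u), (y : R) * ((v⁻¹ : Rˣ) : R) + x) := by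
  have h : dinv (u, (v : R)) = (u⁻¹, ((-(u⁻¹ * v) : Rˣ) : R)) := by
    simp [dinv]
  rw [h, dk_of_unit, dk_of_unit]
  have hinv : (-(u⁻¹ * v))⁻¹ = -(v⁻¹ * u) := by
    rw [inv_eq_iff_mul_eq_one]
    ext
    simp [mul_assoc]
  simp only [dmul, dinv, hinv]
  refine Prod.ext (Units.ext ?_) ?_
  · simp [mul_assoc]
  · simp [mul_assoc]

/-- The Δ-group identity for `(Rˣ × R, Rˣ × Rˣ, k)`: for `p = (x,y)`, `q = (u,v)`
with `x, y, u, v ∈ Rˣ` and `xv + y ∈ Rˣ` (so `(p,q)` is `H`-composable),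
`k(pq)·(k q)⁻¹ = k(k(p)·(k(q⁻¹))⁻¹)`; explicitly
`k(pq)·(k q)⁻¹ = ((xv+y)v⁻¹, -yv⁻¹u)` and `k(p)·(k(q⁻¹))⁻¹ = (-yv⁻¹u, yv⁻¹+x)`. -/
theorem dprod_delta_identity {R : Type*} [Ring R] (x y u v : Rˣ)
    (hc : IsUnit ((x : R) * v + y)) :
    (((dmul (dk (dmul (x, (y : R)) (u, (v : R)))) (dinv (dk (u, (v : R))))).1 : R),
      (dmul (dk (dmul (x, (y : R)) (u, (v : R)))) (dinv (dk (u, (v : R))))).2) =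
      ((((x : R) * v + y) * ((v⁻¹ : Rˣ) : R), -((y : R) * ((v⁻¹ : Rˣ) : R) * u))
        : R × R) ∧
    (((dmul (dk ((x : Rˣ), (y : R))) (dinv (dk (dinv (u, (v : R)))))).1 : R),
      (dmul (dk ((x : Rˣ), (y : R))) (dinv (dk (dinv (u, (v : R)))))).2) =
      ((-((y : R) * ((v⁻¹ : Rˣ) : R) * u), (y : R) * ((v⁻¹ : Rˣ) : R) + x)
        : R × R) ∧
    dmul (dk (dmul (x, (y : R)) (u, (v : R)))) (dinv (dk (u, (v : R)))) =
      dk (dmul (dk ((x : Rˣ), (y : R))) (dinv (dk (dinv (u, (v : R)))))) := by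
  obtain ⟨w, hw⟩ := hc
  have hsum : (y : R) * ((v⁻¹ : Rˣ) : R) + x = ((w * v⁻¹ : Rˣ) : R) := by
    push_cast
    rw [hw, add_mul, mul_assoc, Units.mul_inv, mul_one, add_comm]
  rw [dmul_dk_dmul_dinv_dk x y u v w hw, dmul_dk_dinv_dk_dinv]
  refine ⟨?_, ?_, ?_⟩
  · simp [hw]
  · simp
  · rw [hsum, dk_of_unit]
end

section
/- Let G be a group, G₊ and G₋ subgroups of G, and θ ∈ G with θ² = 1 and G₋ = θG₊θ, such that the multiplication map G₊ × G₋ → G, (g₊,g₋) ↦ g₊g₋, is injective (so every g ∈ G₊G₋ has a unique factorization g = g₊g₋ with g₊ ∈ G₊, g₋ ∈ G₋). Set H = G₊ ∩ G₋G₊θ ∩ θG₊G₋, and for x ∈ H define k(x) = ((θx⁻¹)₊)⁻¹ (note that x ∈ G₋G₊θ implies θx⁻¹ ∈ G₊G₋, so the factorization is defined). Then (G₊, H, k) is a Δ-group: H is closed under the inversion map i : x ↦ x⁻¹, k maps H into H and is an involution, and for every H-composable pair (x,y) (i.e. x, y, xy ∈ H) the pairs (k(xy), ik(y)) and (k(x),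 iki(y)) are H-composable and k(xy)·ik(y) = k(k(x)·iki(y)). -/
/-- Let `(G, G₊, G₋, θ)` be a symmetrically factorized group: `G₊, G₋` are subgroups
of `G`, `θ ∈ G` is an involutive element conjugating `G₊` into `G₋`, and the
multiplication map `G₊ × G₋ → G` is injective, with factorization maps
`plus, minus : G → G` (`g = plus g * minus g` for `g ∈ G₊G₋`).  Set
`H = G₊ ∩ G₋G₊θ ∩ θG₊G₋` and `k(x) = ((θx⁻¹)₊)⁻¹` for `x ∈ H`.  Then `(G₊, H, k)`
is a Δ-group: `H` is closed under inversion, `k` maps `H` to `H` and is an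
involution, and for every `H`-composable pair `(x,y)` the pairs `(k(xy), ik(y))`
and `(k(x), iki(y))` are `H`-composable and `k(xy)·ik(y) = k(k(x)·iki(y))`. -/
theorem factorized_group_delta {G : Type*} [Group G]
    (Gp Gm : Subgroup G) (θ : G)
    (hθ : θ * θ = 1)
    (hconj : ∀ x, x ∈ Gm ↔ θ * x * θ ∈ Gp)
    (hinj : ∀ a b a' b' : G, a ∈ Gp → b ∈ Gm → a' ∈ Gp → b' ∈ Gm →
      a * b = a' * b' → a = a' ∧ b = b')
    (plus minus : G → G)
    (hfact : ∀ g : G, (∃ a ∈ Gp, ∃ b ∈ Gm, g = a * b) →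
      plus g ∈ Gp ∧ minus g ∈ Gm ∧ plus g * minus g = g)
    (H : Set G)
    (hH : ∀ x, x ∈ H ↔ (x ∈ Gp ∧
      (∃ a ∈ Gm, ∃ b ∈ Gp, x = a * b * θ) ∧
      (∃ a ∈ Gp, ∃ b ∈ Gm, x = θ * (a * b))))
    (k : G → G)
    (hk : ∀ x ∈ H, k x = (plus (θ * x⁻¹))⁻¹) :
    (∀ x ∈ H, x⁻¹ ∈ H) ∧
    (∀ x ∈ H, k x ∈ H) ∧
    (∀ x ∈ H, k (k x) = x) ∧
    (∀ x ∈ H, ∀ y ∈ H, x * y ∈ H →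
      k (x * y) * (k y)⁻¹ ∈ H ∧
      k x * (k y⁻¹)⁻¹ ∈ H ∧
      k (x * y) * (k y)⁻¹ = k (k x * (k y⁻¹)⁻¹)) := by
  have hθc : ∀ z, θ * (θ * z) = z := fun z => by rw [← mul_assoc, hθ, one_mul]
  have hconj_plus : ∀ x ∈ Gp, θ * x * θ ∈ Gm := fun x hx => by
    rw [hconj]
    have h : θ * (θ * x * θ) * θ = x := by simp only [mul_assoc, hθ, hθc, mul_one]
    rwa [h]
  -- For `x, c ∈ G₊`, the condition `c θ x⁻¹ ∈ G₋` is symmetric in `x, c`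
  -- and characterizes `c = k x`.
  have hθinv : θ⁻¹ = θ := inv_eq_of_mul_eq_one_right hθ
  have rel_symm : ∀ x c, c * θ * x⁻¹ ∈ Gm → x * θ * c⁻¹ ∈ Gm := fun x c h => by
    simpa only [mul_inv_rev, inv_inv, hθinv, mul_assoc] using Gm.inv_mem h
  have mem_of_rel : ∀ x c, x ∈ Gp → c ∈ Gp → c * θ * x⁻¹ ∈ Gm → x ∈ H := fun x c hx hc h => by
    have h' := rel_symm x c h
    refine (hH x).2 ⟨hx, ⟨_, h', c, hc, ?_⟩, ⟨_, (hconj _).1 h', _, hconj_plus c hc, ?_⟩⟩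
    · simp only [mul_assoc, inv_mul_cancel_left, hθ, mul_one]
    · simp only [mul_assoc, hθ, hθc, inv_mul_cancel_left, mul_one]
  have factorable : ∀ x ∈ H, ∃ a ∈ Gp, ∃ b ∈ Gm, θ * x⁻¹ = a * b := fun x hx => by
    obtain ⟨-, ⟨a, ha, b, hb, rfl⟩, -⟩ := (hH x).1 hx
    refine ⟨b⁻¹, Gp.inv_mem hb, a⁻¹, Gm.inv_mem ha, ?_⟩
    simp only [mul_inv_rev, hθinv, hθc]
  have rel_k : ∀ x ∈ H, k x ∈ Gp ∧ k x * θ * x⁻¹ ∈ Gm := fun x hx => by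
    obtain ⟨hp, hm, h⟩ := hfact _ (factorable x hx)
    rw [hk x hx]
    refine ⟨Gp.inv_mem hp, ?_⟩
    rwa [mul_assoc, inv_mul_eq_of_eq_mul h.symm]
  have k_eq_of_rel : ∀ x c, x ∈ Gp → c ∈ Gp → c * θ * x⁻¹ ∈ Gm → k x = c :=
    fun x c hx hc h => by
    obtain ⟨hp, hm⟩ := rel_k x (mem_of_rel x c hx hc h)
    refine inv_injective (hinj _ _ _ _ (Gp.inv_mem hp) hm (Gp.inv_mem hc) h ?_).1
    simp only [mul_assoc, inv_mul_cancel_left]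
  have mem_plus : ∀ x ∈ H, x ∈ Gp := fun x hx => ((hH x).1 hx).1
  have rel_inv : ∀ y ∈ H, y⁻¹ ∈ H ∧ k y⁻¹ = θ * (k y * θ * y⁻¹) * θ := fun y hy => by
    obtain ⟨hp, hm⟩ := rel_k y hy
    have hy' := Gp.inv_mem (mem_plus y hy)
    have h : θ * (k y * θ * y⁻¹) * θ * θ * y⁻¹⁻¹ ∈ Gm := by
      have e : θ * (k y * θ * y⁻¹) * θ * θ * y⁻¹⁻¹ = θ * k y * θ := by
        simp only [mul_assoc, hθc, inv_inv, inv_mul_cancel, mul_one]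
      rw [e]
      exact hconj_plus _ hp
    exact ⟨mem_of_rel _ _ hy' ((hconj _).1 hm) h, k_eq_of_rel _ _ hy' ((hconj _).1 hm) h⟩
  refine ⟨fun x hx => (rel_inv x hx).1, fun x hx => ?_, fun x hx => ?_, fun x hx y hy hxy => ?_⟩
  · obtain ⟨hp, hm⟩ := rel_k x hx
    exact mem_of_rel _ x hp (mem_plus x hx) (rel_symm _ _ hm)
  · obtain ⟨hp, hm⟩ := rel_k x hx
    exact k_eq_of_rel _ x hp (mem_plus x hx) (rel_symm _ _ hm)
  · obtain ⟨hc, hcm⟩ := rel_k _ hxy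
    obtain ⟨hd, -⟩ := rel_k y hy
    obtain ⟨he, hem⟩ := rel_k x hx
    obtain ⟨hy', hky'⟩ := rel_inv y hy
    obtain ⟨hf, -⟩ := rel_k _ hy'
    have hcd := Gp.mul_mem hc (Gp.inv_mem hd)
    have hef := Gp.mul_mem he (Gp.inv_mem hf)
    have h : k (x * y) * (k y)⁻¹ * θ * (k x * (k y⁻¹)⁻¹)⁻¹ ∈ Gm := by
      have e : k (x * y) * (k y)⁻¹ * θ * (k x * (k y⁻¹)⁻¹)⁻¹ =
          (k (x * y) * θ * (x * y)⁻¹) * (k x * θ * x⁻¹)⁻¹ := by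
        rw [hky']
        simp only [mul_inv_rev, inv_inv, hθinv, mul_assoc, hθc, inv_mul_cancel_left]
      rw [e]
      exact Gm.mul_mem hcm (Gm.inv_mem hem)
    exact ⟨mem_of_rel _ _ hcd hef (rel_symm _ _ h), mem_of_rel _ _ hef hcd h,
      (k_eq_of_rel _ _ hef hcd h).symm⟩
end
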